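/- arXiv:1512.02698 — 2 statements merged into one kernel-verified Lean document; each statement's English description precedes it below -/
import Mathlib

section
/- (Billboard Lemma) Let M : T^n → Δ(O) be an (ε,δ)-differentially private mechanism and let θ : T × O → A be any function. Define the mechanism M' : T^n → Δ(A^n) which, on input τ, samples o ∼ M(τ) and outputs to each player i the value M'(τ)_i = θ(τ_i, o). Then M' satisfies (ε,δ)-joint differential privacy. -/
open Finset

/-- **The Billboard Lemma.**
If `M : Tᵑ → Δ(O)` is `(ε,δ)`-differentially private and `θ : T × O → A` is any function,
then the mechanism `M'` that samples `o ∼ M(τ)` and outputs `θ(τ_i, o)` to each player `i`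
is `(ε,δ)`-jointly differentially private: for every player `i`, every pair of types for
`i`, and every event `B` over joint action profiles that does not depend on player `i`'s
coordinate, the probability of `B` changes by at most an `(e^ε, δ)` factor. -/
theorem billboard_lemma
    (n : ℕ) (T O A : Type) [Fintype O] [DecidableEq A]
    (M : (Fin n → T) → O → ℝ)
    (hMdist : ∀ τ, (∀ o, 0 ≤ M τ o) ∧ ∑ o, M τ o = 1)
    -- (ε,δ)-differential privacy of M
    (ε δ : ℝ)
    (hDP : ∀ (i : Fin n) (r r' : T) (τrest : Fin n → T) (B : Finset O),
      ∑ o ∈ B, M (Function.update τrest i r) o ≤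
        Real.exp ε * ∑ o ∈ B, M (Function.update τrest i r') o + δ)
    (θ : T → O → A) :
    -- joint differential privacy of M'(τ)_i = θ(τ_i, o), o ∼ M(τ):
    ∀ (i : Fin n) (r r' : T) (τrest : Fin n → T) (B : Finset (Fin n → A)),
      (∀ a a' : Fin n → A, (∀ j, j ≠ i → a j = a' j) → (a ∈ B ↔ a' ∈ B)) →
      ∑ o ∈ Finset.univ.filter
          (fun o => (fun j => θ (Function.update τrest i r j) o) ∈ B),
        M (Function.update τrest i r) o ≤
      Real.exp ε * ∑ o ∈ Finset.univ.filter
          (fun o => (fun j => θ (Function.update τrest i r' j) o) ∈ B),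
        M (Function.update τrest i r') o + δ := by
  intro i r r' τrest B hB
  have hfilter : Finset.univ.filter
        (fun o => (fun j => θ (Function.update τrest i r j) o) ∈ B) =
      Finset.univ.filter
        (fun o => (fun j => θ (Function.update τrest i r' j) o) ∈ B) := by
    refine Finset.filter_congr fun o _ => hB _ _ fun j hj => ?_
    simp only [Function.update_of_ne hj]
  rw [hfilter]
  exact hDP i r r' τrest _
end

section
/- In the lower-bound game constructed from a database D = (d_1,…,d_n) ∈ {0,1}^n and queries Q, let π be any distribution over action profiles that constitutes an α-approximate coarse correlated equilibrium. Then for every subset-sum query q ⊆ {1,…,n}, E_{a∼π}[| q(d_1,…,d_n) − q(a_1,…,a_n) |] ≤ α. -/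
open Finset

/-- The players of the lower-bound game: `n` data players and `n'·⌊log₂ n⌋` query
players, one per query `j` and bit index `h`. -/
abbrev LBPlayer (n n' : ℕ) := Fin n ⊕ (Fin n' × Fin (Nat.log 2 n))

/-- The value of the subset-sum query `q` on the bit vector `x`:
`q(x) = (1/n)·|{i ∈ q : x_i = 1}|`. -/
noncomputable def qval (n : ℕ) (q : Finset (Fin n)) (x : Fin n → Bool) : ℝ :=
  ((q.filter fun i => x i = true).card : ℝ) / n

/-- `f_h(x) = 1 − min_{r ∈ {0,…,2^{h−1}−1}} |x − (2^{−(h+1)} + r·2^{−(h−1)})|`. -/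
noncomputable def fConf (h : ℕ) (x : ℝ) : ℝ :=
  1 - (Finset.range (2 ^ (h - 1))).inf'
        ⟨0, Finset.mem_range.mpr (by positivity)⟩
        (fun r => |x - (((2 : ℝ) ^ (h + 1))⁻¹ + (r : ℝ) * ((2 : ℝ) ^ (h - 1))⁻¹)|)

/-- `g_h(x) = 1 − min_{r ∈ {0,…,2^{h−1}−1}} |x − (2^{−h} + 2^{−(h+1)} + r·2^{−(h−1)})|`. -/
noncomputable def gConf (h : ℕ) (x : ℝ) : ℝ :=
  1 - (Finset.range (2 ^ (h - 1))).inf'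
        ⟨0, Finset.mem_range.mpr (by positivity)⟩
        (fun r => |x - (((2 : ℝ) ^ h)⁻¹ + ((2 : ℝ) ^ (h + 1))⁻¹ +
          (r : ℝ) * ((2 : ℝ) ^ (h - 1))⁻¹)|)

/-- The utilities of the lower-bound game built from database `d` and queries `q`:
data player `i` gets `1` iff her action matches `d i`; query player `(j,h)` gets
`f_{h+1}(q_j(a))` when playing `0` (here `false`) and `g_{h+1}(q_j(a))` when playing `1`
(here `true`). -/
noncomputable def lbUtility (n n' : ℕ) (d : Fin n → Bool) (q : Fin n' → Finset (Fin n)) :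
    LBPlayer n n' → (LBPlayer n n' → Bool) → ℝ
  | Sum.inl i => fun a => if a (Sum.inl i) = d i then 1 else 0
  | Sum.inr (j, h) => fun a =>
      if a (Sum.inr (j, h)) = false then
        fConf (h.val + 1) (qval n (q j) (fun i => a (Sum.inl i)))
      else gConf (h.val + 1) (qval n (q j) (fun i => a (Sum.inl i)))

/-- `π` is an `α`-approximate coarse correlated equilibrium of the lower-bound game. -/
noncomputable def lbIsCCE (n n' : ℕ) (d : Fin n → Bool) (q : Fin n' → Finset (Fin n))
    (α : ℝ) (π : (LBPlayer n n' → Bool) → ℝ) : Prop :=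
  (∀ a, 0 ≤ π a) ∧ (∑ a, π a = 1) ∧
    ∀ (p : LBPlayer n n') (b' : Bool),
      ∑ a, π a * lbUtility n n' d q p a ≥
        ∑ a, π a * lbUtility n n' d q p (Function.update a p b') - α

/-- The values of a subset-sum query on two bit vectors differ by at most the fraction of
coordinates in which the vectors disagree. -/
lemma abs_qval_sub_le (n : ℕ) (q : Finset (Fin n)) (x y : Fin n → Bool) :
    |qval n q x - qval n q y| ≤ (∑ i, (1 - if y i = x i then (1 : ℝ) else 0)) / n := by
  unfold qval
  rw [← sub_div, abs_div, Nat.abs_cast]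
  gcongr
  rw [Finset.card_filter, Finset.card_filter]
  push_cast
  rw [← Finset.sum_sub_distrib]
  calc |∑ i ∈ q, ((if x i = true then (1 : ℝ) else 0) - if y i = true then 1 else 0)|
      ≤ ∑ i ∈ q, |(if x i = true then (1 : ℝ) else 0) - if y i = true then 1 else 0| :=
        Finset.abs_sum_le_sum_abs _ _
    _ ≤ ∑ i ∈ q, (1 - if y i = x i then (1 : ℝ) else 0) := by
        refine Finset.sum_le_sum fun i _ => ?_
        cases x i <;> cases y i <;> norm_num
    _ ≤ ∑ i, (1 - if y i = x i then (1 : ℝ) else 0) := by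
        refine Finset.sum_le_sum_of_subset_of_nonneg (Finset.subset_univ q) fun i _ _ => ?_
        split_ifs <;> norm_num

/-- In an `α`-approximate coarse correlated equilibrium every data player disagrees with her
database entry with probability at most `α`. -/
lemma lbIsCCE.sum_disagree_le {n n' : ℕ} {d : Fin n → Bool} {q : Fin n' → Finset (Fin n)}
    {α : ℝ} {π : (LBPlayer n n' → Bool) → ℝ} (hπ : lbIsCCE n n' d q α π) (i : Fin n) :
    ∑ a, π a * (1 - if a (Sum.inl i) = d i then (1 : ℝ) else 0) ≤ α := by
  obtain ⟨-, hsum, hdev⟩ := hπ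
  have h := hdev (Sum.inl i) (d i)
  simp only [lbUtility, Function.update_self, if_true, mul_one, hsum] at h
  simp only [mul_sub, Finset.sum_sub_distrib, mul_one, hsum]
  linarith

/-- **Claim D.2 (query values are accurate on average).**
In any `α`-approximate coarse correlated equilibrium `π` of the lower-bound game built
from database `d` and queries `q`, for every subset-sum query `q'` the expected
difference between `q'` evaluated on the database and on the data players' actions is at
most `α`. -/
theorem lb_queries_accurate
    (n n' : ℕ) (hn : 0 < n)
    (d : Fin n → Bool) (q : Fin n' → Finset (Fin n))
    (α : ℝ) (π : (LBPlayer n n' → Bool) → ℝ)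
    (hπ : lbIsCCE n n' d q α π) :
    ∀ q' : Finset (Fin n),
      ∑ a : LBPlayer n n' → Bool,
        π a * |qval n q' d - qval n q' (fun i => a (Sum.inl i))| ≤ α := by
  intro q'
  have hn' : (0 : ℝ) < n := Nat.cast_pos.mpr hn
  calc ∑ a, π a * |qval n q' d - qval n q' (fun i => a (Sum.inl i))|
      ≤ ∑ a, π a * ((∑ i, (1 - if a (Sum.inl i) = d i then (1 : ℝ) else 0)) / n) :=
        Finset.sum_le_sum fun a _ =>
          mul_le_mul_of_nonneg_left (abs_qval_sub_le n q' d _) (hπ.1 a)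
    _ = (∑ i, ∑ a, π a * (1 - if a (Sum.inl i) = d i then (1 : ℝ) else 0)) / n := by
        rw [Finset.sum_comm, Finset.sum_div]
        simp only [mul_div_assoc', Finset.mul_sum]
    _ ≤ (∑ _i : Fin n, α) / n := by
        gcongr with i
        exact hπ.sum_disagree_le i
    _ = α := by
        rw [Finset.sum_const, Finset.card_univ, Fintype.card_fin, nsmul_eq_mul,
          mul_div_cancel_left₀ _ hn'.ne']
end
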